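/- No False Positive Theorem: under the Dense Dataset and Similarity Classifier Smoothness assumptions, the procedure TheoreticalFlowVerify(i, D) returns False whenever the ground-truth class of D differs from O_i. -/

import Mathlib

/-- Action of a pixel permutation on an image. -/
def act {P C : Type*} (σ : Equiv.Perm P) (x : P → C) : P → C :=
  fun p => x (σ.symm p)

/-- No False Positive Theorem: under the Dense Dataset and Similarity Classifier
Smoothness assumptions, `TheoreticalFlowVerify (i, D)` returns False whenever
the ground-truth class `O j` of `D` differs from `O i`.  The existential in the
conclusion is `TheoreticalFlowVerify`; the conjunction is `VerifyMatch`. -/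
theorem stmt5 {P C K : Type*}
    {M : K → Type*} [∀ k, Fintype (M k)] [∀ k, Nonempty (M k)]
    (d : (P → C) → (P → C) → ℝ)
    (htri : ∀ x y z, d x z ≤ d x y + d y z)
    (hsymm : ∀ x y, d x y = d y x)
    (hperm : ∀ (σ : Equiv.Perm P) (x y : P → C), d (act σ x) (act σ y) = d x y)
    (TR : Set (Equiv.Perm P))
    (hmul : ∀ σ τ : Equiv.Perm P, σ ∈ TR → τ ∈ TR → σ * τ ∈ TR)
    (hinv : ∀ σ : Equiv.Perm P, σ ∈ TR → σ⁻¹ ∈ TR)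
    (c : (P → C) → (P → C) → ℝ) (γ δ : ℝ)
    (r : Equiv.Perm P → ℝ)
    (hr : ∀ T, r T = 1 ↔ T ∈ TR)
    (tmpl : (k : K) → M k → (P → C))
    (F : (k : K) → M k → (P → C) → Equiv.Perm P)
    (i j : K) (hij : j ≠ i) (D : P → C)
    (hdense : ∃ n : M j, ∃ T ∈ TR, d (act T (tmpl j n)) D ≤ γ)
    (hsmooth : ∀ (I₁ I₂ D' : P → C),
      (∃ T ∈ TR, d (act T I₁) I₂ ≤ 2 * γ) → |c I₁ D' - c I₂ D'| < δ) :
    ¬ ∃ m : M i,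
        ((∀ j' : K, j' ≠ i → ∀ n : M j', c (tmpl j' n) D + δ ≤ c (tmpl i m) D) ∧
          d (act (F i m D) (tmpl i m)) D ≤ γ ∧
          r (F i m D) = 1) := by
  rintro ⟨m, h1, h2, h3⟩
  obtain ⟨n, T, hT, hd⟩ := hdense
  have hS := (hr _).1 h3
  have hc := hsmooth (tmpl i m) (tmpl j n) D
    ⟨T⁻¹ * F i m D, hmul _ _ (hinv _ hT) hS, by
      have e : act T (act (T⁻¹ * F i m D) (tmpl i m)) = act (F i m D) (tmpl i m) := by
        funext p
        change tmpl i m ((T⁻¹ * F i m D)⁻¹ (T⁻¹ p)) = tmpl i m ((F i m D)⁻¹ p)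
        simp
      rw [← hperm T, e]
      have t := htri (act (F i m D) (tmpl i m)) D (act T (tmpl j n))
      rw [hsymm D] at t
      linarith⟩
  have := h1 j hij n
  have := (abs_lt.1 hc).2
  linarith
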